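/- With the notation of the discrete suspension: let X be a one-sided subshift of finite type, μ a σ-invariant Borel probability measure, δ > 0, m ∈ ℕ, and g : X → (0,∞) constant on cylinders of length m with values in δℤ and g ≥ δ. Then for every Borel set I ⊆ X that is a union of cylinders of length at least m and every real t > δ: K_D(μ̃^g, ⌈t/δ⌉, I×{0}) ≤ K(μ^g, t, I×{0}, Λ_g) ≤ K_D(μ̃^g, ⌊t/δ⌋, I×{0}). -/

import Mathlib

open Filter Set MeasureTheory

noncomputable section

/-- The one-sided full shift map on sequences over the alphabet `Fin a`. -/
def shiftMap (a : ℕ) : (ℕ → Fin a) → (ℕ → Fin a) := fun x n => x (n + 1)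

/-- The one-sided subshift of finite type determined by the 0-1 transition matrix `A`. -/
def SFT {a : ℕ} (A : Matrix (Fin a) (Fin a) ℕ) : Set (ℕ → Fin a) :=
  {x | ∀ n, A (x n) (x (n + 1)) = 1}

/-- The cylinder of length `n` around `x`. -/
def cyl {a : ℕ} (x : ℕ → Fin a) (n : ℕ) : Set (ℕ → Fin a) := {y | ∀ i < n, y i = x i}

/-- The Birkhoff sum `S_m f(x) = Σ_{k<m} f(σ^k x)`. -/
def birkhoff {a : ℕ} (f : (ℕ → Fin a) → ℝ) (m : ℕ) (x : ℕ → Fin a) : ℝ :=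
  ∑ k ∈ Finset.range m, f ((shiftMap a)^[k] x)

/-- The suspension space `Λ_f = {(x,t) : x ∈ X, 0 ≤ t < f(x)}`. -/
def susp {a : ℕ} (X : Set (ℕ → Fin a)) (f : (ℕ → Fin a) → ℝ) : Set ((ℕ → Fin a) × ℝ) :=
  {p | p.1 ∈ X ∧ 0 ≤ p.2 ∧ p.2 < f p.1}

open Classical in
/-- The special semi-flow `Φ_f^t` over the shift with roof function `f`:
`Φ_f^t(x,s) = (σ^m x, s + t − S_m f(x))` where `S_m f(x) ≤ s+t < S_{m+1} f(x)`. -/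
def susFlow {a : ℕ} (f : (ℕ → Fin a) → ℝ) (t : ℝ) (p : (ℕ → Fin a) × ℝ) :
    (ℕ → Fin a) × ℝ :=
  if h : ∃ m : ℕ, birkhoff f m p.1 ≤ p.2 + t ∧ p.2 + t < birkhoff f (m + 1) p.1 then
    ((shiftMap a)^[h.choose] p.1, p.2 + t - birkhoff f h.choose p.1)
  else p

/-- The normalized suspension measure `μ^f = (μ × Leb)/∫ f dμ` on `Λ_f`. -/
def suspMeasure {a : ℕ} (μ : Measure (ℕ → Fin a)) [SFinite μ] (X : Set (ℕ → Fin a))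
    (f : (ℕ → Fin a) → ℝ) : Measure ((ℕ → Fin a) × ℝ) :=
  (ENNReal.ofReal (∫ x, f x ∂μ))⁻¹ • ((μ.prod volume).restrict (susp X f))

/-- `K(ν,t,H,Λ_f) = log ν{p ∈ Λ_f : Φ_f^s p ∉ H for all s ∈ [0,t]}`, valued in `EReal`
(so that `log 0 = ⊥`). -/
def Kc {a : ℕ} (ν : Measure ((ℕ → Fin a) × ℝ)) (t : ℝ) (H : Set ((ℕ → Fin a) × ℝ))
    (X : Set (ℕ → Fin a)) (f : (ℕ → Fin a) → ℝ) : EReal :=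
  ENNReal.log (ν {p | p ∈ susp X f ∧ ∀ s ∈ Set.Icc (0 : ℝ) t, susFlow f s p ∉ H})


/-- The discrete suspension space `Λ̃_g = {(x,j) : x ∈ X, 0 ≤ j < g(x)/δ}`. -/
def discSusp {a : ℕ} (X : Set (ℕ → Fin a)) (g : (ℕ → Fin a) → ℝ) (δ : ℝ) :
    Set ((ℕ → Fin a) × ℤ) :=
  {p | p.1 ∈ X ∧ 0 ≤ p.2 ∧ ((p.2 : ℤ) : ℝ) < g p.1 / δ}

open Classical in
/-- The discrete suspension map `T_g(x,j) = (x,j+1)` if `j+1 < g(x)/δ`, and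
`T_g(x,j) = (σ x, 0)` if `j+1 = g(x)/δ`. -/
def discT {a : ℕ} (g : (ℕ → Fin a) → ℝ) (δ : ℝ) (p : (ℕ → Fin a) × ℤ) :
    (ℕ → Fin a) × ℤ :=
  if ((p.2 + 1 : ℤ) : ℝ) < g p.1 / δ then (p.1, p.2 + 1) else (shiftMap a p.1, 0)

/-- The discrete suspension measure `μ̃^g = (δ/∫g dμ)·(μ × counting)` restricted to `Λ̃_g`. -/
def discMeasure {a : ℕ} (μ : Measure (ℕ → Fin a)) [SFinite μ] (X : Set (ℕ → Fin a))
    (g : (ℕ → Fin a) → ℝ) (δ : ℝ) : Measure ((ℕ → Fin a) × ℤ) :=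
  (ENNReal.ofReal (δ / ∫ x, g x ∂μ)) •
    ((μ.prod (Measure.count : Measure ℤ)).restrict (discSusp X g δ))

/-- `K_D(ν̃, k, H) = log ν̃{y ∈ Λ̃_g : T_g^i y ∉ H for i = 0,…,k−1}`, valued in `EReal`. -/
def KD {a : ℕ} (ν : Measure ((ℕ → Fin a) × ℤ)) (k : ℕ) (H : Set ((ℕ → Fin a) × ℤ))
    (X : Set (ℕ → Fin a)) (g : (ℕ → Fin a) → ℝ) (δ : ℝ) : EReal :=
  ENNReal.log (ν {p | p ∈ discSusp X g δ ∧ ∀ i < k, (discT g δ)^[i] p ∉ H})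

section Roof

variable {a : ℕ} {g : (ℕ → Fin a) → ℝ} {δ : ℝ}

lemma measurable_shiftMap (a : ℕ) : Measurable (shiftMap a) :=
  measurable_pi_lambda _ fun n => measurable_pi_apply (n + 1)

lemma measurableSet_SFT (A : Matrix (Fin a) (Fin a) ℕ) : MeasurableSet (SFT A) := by
  have h : SFT A = ⋂ n, (fun x : ℕ → Fin a => (x n, x (n + 1))) ⁻¹' {q | A q.1 q.2 = 1} := by
    ext x
    simp [SFT]
  rw [h]
  exact MeasurableSet.iInter fun n =>
    ((measurable_pi_apply n).prodMk (measurable_pi_apply (n + 1))) (Set.toFinite _).measurableSet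

lemma shiftMap_mem_SFT {A : Matrix (Fin a) (Fin a) ℕ} {x : ℕ → Fin a} (hx : x ∈ SFT A) :
    shiftMap a x ∈ SFT A := fun n => hx (n + 1)

/-- A function of the first `m` coordinates factors through the finite set of words. -/
lemma exists_factor_of_const_on_cylinders {m : ℕ}
    (hg : ∀ x y : ℕ → Fin a, (∀ i < m, x i = y i) → g x = g y) :
    ∃ G : (Fin m → Fin a) → ℝ, g = G ∘ fun x i => x i := by
  have h : Function.FactorsThrough g (fun (x : ℕ → Fin a) (i : Fin m) => x i) := by
    intro x y hxy
    exact hg x y fun i hi => congrFun hxy ⟨i, hi⟩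
  obtain ⟨G, hG⟩ := (Function.factorsThrough_iff g).1 h
  exact ⟨G, hG⟩

lemma measurable_of_const_on_cylinders {m : ℕ}
    (hg : ∀ x y : ℕ → Fin a, (∀ i < m, x i = y i) → g x = g y) : Measurable g := by
  obtain ⟨G, rfl⟩ := exists_factor_of_const_on_cylinders hg
  exact (measurable_of_finite G).comp
    (measurable_pi_lambda _ fun i => measurable_pi_apply (i : ℕ))

lemma integrable_of_const_on_cylinders {m : ℕ} (μ : Measure (ℕ → Fin a)) [IsFiniteMeasure μ]
    (hg : ∀ x y : ℕ → Fin a, (∀ i < m, x i = y i) → g x = g y) : Integrable g μ := by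
  have hm := measurable_of_const_on_cylinders hg
  obtain ⟨G, rfl⟩ := exists_factor_of_const_on_cylinders hg
  obtain ⟨C, hC⟩ := (Set.finite_range fun w => ‖G w‖).bddAbove
  exact Integrable.of_bound hm.aestronglyMeasurable C
    (Eventually.of_forall fun x => hC ⟨fun i => x i, rfl⟩)

lemma birkhoff_succ (f : (ℕ → Fin a) → ℝ) (k : ℕ) (x : ℕ → Fin a) :
    birkhoff f (k + 1) x = birkhoff f k x + f ((shiftMap a)^[k] x) :=
  Finset.sum_range_succ _ _

lemma birkhoff_strictMono (hδ : 0 < δ) (hg : ∀ x, δ ≤ g x) (x : ℕ → Fin a) :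
    StrictMono fun k => birkhoff g k x :=
  strictMono_nat_of_lt_succ fun k => by
    rw [birkhoff_succ]
    linarith [hg ((shiftMap a)^[k] x)]

lemma birkhoff_index_unique (hδ : 0 < δ) (hg : ∀ x, δ ≤ g x) {x : ℕ → Fin a} {u : ℝ} {k l : ℕ}
    (hk : birkhoff g k x ≤ u) (hk' : u < birkhoff g (k + 1) x)
    (hl : birkhoff g l x ≤ u) (hl' : u < birkhoff g (l + 1) x) : k = l := by
  have hmono := birkhoff_strictMono hδ hg x
  have h1 : k < l + 1 := hmono.lt_iff_lt.1 (hk.trans_lt hl')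
  have h2 : l < k + 1 := hmono.lt_iff_lt.1 (hl.trans_lt hk')
  omega

lemma mul_le_birkhoff (hg : ∀ x, δ ≤ g x) (x : ℕ → Fin a) (k : ℕ) :
    k * δ ≤ birkhoff g k x := by
  induction k with
  | zero => simp [birkhoff]
  | succ k ih =>
    rw [birkhoff_succ]
    push_cast
    linarith [hg ((shiftMap a)^[k] x)]

lemma exists_birkhoff_index (hδ : 0 < δ) (hg : ∀ x, δ ≤ g x) (x : ℕ → Fin a) {u : ℝ}
    (hu : 0 ≤ u) : ∃ k, birkhoff g k x ≤ u ∧ u < birkhoff g (k + 1) x := by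
  classical
  have hex : ∃ k, u < birkhoff g (k + 1) x := by
    obtain ⟨n, hn⟩ := exists_nat_gt (u / δ)
    refine ⟨n, ?_⟩
    have h1 := mul_le_birkhoff hg x (n + 1)
    rw [div_lt_iff₀ hδ] at hn
    push_cast at h1
    linarith
  refine ⟨Nat.find hex, ?_, Nat.find_spec hex⟩
  rcases Nat.eq_zero_or_pos (Nat.find hex) with h0 | hpos
  · rw [h0]
    simpa [birkhoff] using hu
  · have h := Nat.find_min hex (m := Nat.find hex - 1) (by omega)
    rw [Nat.sub_add_cancel hpos] at h
    exact not_lt.1 h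

lemma exists_birkhoff_eq_int_mul (hg : ∀ x, ∃ j : ℤ, g x = j * δ) (x : ℕ → Fin a) (k : ℕ) :
    ∃ N : ℤ, birkhoff g k x = N * δ := by
  induction k with
  | zero => exact ⟨0, by simp [birkhoff]⟩
  | succ k ih =>
    obtain ⟨N, hN⟩ := ih
    obtain ⟨j, hj⟩ := hg ((shiftMap a)^[k] x)
    exact ⟨N + j, by rw [birkhoff_succ, hN, hj]; push_cast; ring⟩

/-- The semi-flow meets `I × {0}` exactly at the times when a Birkhoff sum is reached. -/
lemma susFlow_mem_iff (hδ : 0 < δ) (hg : ∀ x, δ ≤ g x) {I : Set (ℕ → Fin a)} {x : ℕ → Fin a}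
    {s u : ℝ} (hsu : 0 ≤ s + u) :
    susFlow g u (x, s) ∈ I ×ˢ ({0} : Set ℝ) ↔
      ∃ k, birkhoff g k x = s + u ∧ (shiftMap a)^[k] x ∈ I := by
  have hex : ∃ k, birkhoff g k x ≤ s + u ∧ s + u < birkhoff g (k + 1) x :=
    exists_birkhoff_index hδ hg x hsu
  have hflow : susFlow g u (x, s) =
      ((shiftMap a)^[hex.choose] x, s + u - birkhoff g hex.choose x) := dif_pos hex
  have hspec := hex.choose_spec
  rw [hflow]
  generalize hex.choose = l at hspec
  simp only [mem_prod, mem_singleton_iff]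
  constructor
  · rintro ⟨hI, h0⟩
    exact ⟨l, by linarith, hI⟩
  · rintro ⟨k, hk, hI⟩
    have hkl : k = l := birkhoff_index_unique hδ hg hk.le
      (hk ▸ birkhoff_strictMono hδ hg x (Nat.lt_succ_self k)) hspec.1 hspec.2
    subst hkl
    exact ⟨hI, by linarith⟩

lemma mem_discSusp_iff {X : Set (ℕ → Fin a)} (hδ : 0 < δ) {x : ℕ → Fin a} {j : ℤ} :
    (x, j) ∈ discSusp X g δ ↔ x ∈ X ∧ 0 ≤ j ∧ j * δ < g x := by
  simp [discSusp, lt_div_iff₀ hδ]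

lemma add_one_mul_le_of_mul_lt (hδ : 0 < δ) (hgval : ∀ x, ∃ j : ℤ, g x = j * δ)
    {x : ℕ → Fin a} {j : ℤ} (h : j * δ < g x) : (j + 1) * δ ≤ g x := by
  obtain ⟨N, hN⟩ := hgval x
  rw [hN] at h ⊢
  have h1 : (j : ℝ) < N := lt_of_mul_lt_mul_right h hδ.le
  have h2 : (j : ℝ) + 1 ≤ N := by exact_mod_cast h1
  exact mul_le_mul_of_nonneg_right h2 hδ.le

/-- The orbit of the discrete suspension map in terms of Birkhoff sums. -/
lemma exists_discT_iterate (hδ : 0 < δ) (hg : ∀ x, δ ≤ g x)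
    (hgval : ∀ x, ∃ j : ℤ, g x = j * δ) {x : ℕ → Fin a} {j : ℤ} (hj : 0 ≤ j)
    (hjx : j * δ < g x) (i : ℕ) :
    ∃ (k : ℕ) (l : ℤ), (discT g δ)^[i] (x, j) = ((shiftMap a)^[k] x, l) ∧ 0 ≤ l ∧
      l * δ < g ((shiftMap a)^[k] x) ∧ birkhoff g k x + l * δ = (j + i) * δ := by
  induction i with
  | zero => exact ⟨0, j, rfl, hj, hjx, by simp [birkhoff]⟩
  | succ i ih =>
    obtain ⟨k, l, hT, hl, hlx, hS⟩ := ih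
    rw [Function.iterate_succ_apply', hT]
    by_cases h : ((l + 1 : ℤ) : ℝ) < g ((shiftMap a)^[k] x) / δ
    · refine ⟨k, l + 1, if_pos h, by omega, (lt_div_iff₀ hδ).1 h, ?_⟩
      push_cast
      linarith
    · refine ⟨k + 1, 0, ?_, le_rfl, ?_, ?_⟩
      · rw [Function.iterate_succ_apply']
        exact if_neg h
      · simpa using hδ.trans_le (hg _)
      · have h1 := add_one_mul_le_of_mul_lt hδ hgval hlx
        rw [lt_div_iff₀ hδ, not_lt] at h
        rw [birkhoff_succ]
        push_cast at h ⊢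
        linarith

lemma discT_iterate_mem_iff (hδ : 0 < δ) (hg : ∀ x, δ ≤ g x)
    (hgval : ∀ x, ∃ j : ℤ, g x = j * δ) {I : Set (ℕ → Fin a)} {x : ℕ → Fin a} {j : ℤ}
    (hj : 0 ≤ j) (hjx : j * δ < g x) (i : ℕ) :
    (discT g δ)^[i] (x, j) ∈ I ×ˢ ({0} : Set ℤ) ↔
      ∃ k, birkhoff g k x = (j + i) * δ ∧ (shiftMap a)^[k] x ∈ I := by
  obtain ⟨l, r, hT, hr, hrx, hS⟩ := exists_discT_iterate hδ hg hgval hj hjx i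
  rw [hT]
  simp only [mem_prod, mem_singleton_iff]
  constructor
  · rintro ⟨hI, h0⟩
    subst h0
    exact ⟨l, by simpa using hS, hI⟩
  · rintro ⟨k, hk, hI⟩
    have hr' : (0 : ℝ) ≤ r * δ := mul_nonneg (by exact_mod_cast hr) hδ.le
    have hkl : k = l := birkhoff_index_unique hδ hg hk.le
      (hk ▸ birkhoff_strictMono hδ hg x (Nat.lt_succ_self k)) (by linarith)
      (by rw [birkhoff_succ]; linarith)
    subst hkl
    refine ⟨hI, ?_⟩
    have h0 : (r : ℝ) * δ = 0 := by linarith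
    exact_mod_cast (mul_eq_zero.1 h0).resolve_right hδ.ne'

lemma discT_mem_discSusp {A : Matrix (Fin a) (Fin a) ℕ} (hδ : 0 < δ) (hg : ∀ x, δ ≤ g x)
    {p : (ℕ → Fin a) × ℤ} (hp : p ∈ discSusp (SFT A) g δ) :
    discT g δ p ∈ discSusp (SFT A) g δ := by
  obtain ⟨hX, h0, -⟩ := hp
  unfold discT
  split_ifs with h
  · exact ⟨hX, by simp only; omega, h⟩
  · exact ⟨shiftMap_mem_SFT hX, le_rfl, by simpa using div_pos (hδ.trans_le (hg _)) hδ⟩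

lemma measurableSet_discSusp {X : Set (ℕ → Fin a)} (hX : MeasurableSet X) (hg : Measurable g) :
    MeasurableSet (discSusp X g δ) := by
  have h2 : Measurable fun p : (ℕ → Fin a) × ℤ => ((p.2 : ℤ) : ℝ) :=
    (measurable_of_countable (fun j : ℤ => (j : ℝ))).comp measurable_snd
  exact (measurable_fst hX).inter (((measurableSet_Ici (a := (0 : ℤ))).preimage
    measurable_snd).inter (measurableSet_lt h2 ((hg.comp measurable_fst).div_const δ)))

lemma measurableSet_add_one_lt (hg : Measurable g) :
    MeasurableSet {p : (ℕ → Fin a) × ℤ | ((p.2 + 1 : ℤ) : ℝ) < g p.1 / δ} :=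
  measurableSet_lt ((measurable_of_countable (fun j : ℤ => ((j + 1 : ℤ) : ℝ))).comp
    measurable_snd) ((hg.comp measurable_fst).div_const δ)

lemma measurable_discT (hg : Measurable g) : Measurable (discT g δ) := by
  unfold discT
  refine Measurable.ite (measurableSet_add_one_lt hg) ?_ ?_
  · exact measurable_fst.prodMk ((measurable_of_countable (fun j : ℤ => j + 1)).comp
      measurable_snd)
  · exact ((measurable_shiftMap a).comp measurable_fst).prodMk measurable_const

/-- The discrete suspension map preserves the product of an invariant measure with counting
measure, restricted to the discrete suspension. -/
lemma prod_count_preimage_discT {A : Matrix (Fin a) (Fin a) ℕ} {μ : Measure (ℕ → Fin a)}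
    [IsProbabilityMeasure μ] (hsupp : μ (SFT A) = 1)
    (hinv : ∀ B : Set (ℕ → Fin a), MeasurableSet B → μ (shiftMap a ⁻¹' B) = μ B)
    (hδ : 0 < δ) (hg : Measurable g) (hgδ : ∀ x, δ ≤ g x)
    (hgval : ∀ x, ∃ j : ℤ, g x = j * δ) {E : Set ((ℕ → Fin a) × ℤ)} (hE : MeasurableSet E)
    (hED : E ⊆ discSusp (SFT A) g δ) :
    (μ.prod Measure.count) (discSusp (SFT A) g δ ∩ discT g δ ⁻¹' E) =
      (μ.prod Measure.count) E := by
  set M : Measure ((ℕ → Fin a) × ℤ) := μ.prod Measure.count with hM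
  set D := discSusp (SFT A) g δ with hD
  set P := {p : (ℕ → Fin a) × ℤ | ((p.2 + 1 : ℤ) : ℝ) < g p.1 / δ} with hP
  set Z := {p : (ℕ → Fin a) × ℤ | p.2 = 0} with hZ
  have hPm : MeasurableSet P := measurableSet_add_one_lt hg
  have hZm : MeasurableSet Z := measurable_snd (measurableSet_singleton (0 : ℤ))
  have hDm : MeasurableSet D := measurableSet_discSusp (measurableSet_SFT A) hg
  have hE'm : MeasurableSet (D ∩ discT g δ ⁻¹' E) := hDm.inter (measurable_discT hg hE)
  have hE0m : MeasurableSet {x | (x, (0 : ℤ)) ∈ E} := measurable_prodMk_right hE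
  have hup : M ((D ∩ discT g δ ⁻¹' E) ∩ P) = M (E \ Z) := by
    have hshift : MeasurePreserving (fun j : ℤ => j + 1) Measure.count Measure.count :=
      measurePreserving_add_right _ 1
    have hmp : MeasurePreserving (Prod.map id fun j : ℤ => j + 1) M M :=
      (MeasurePreserving.id μ).prod hshift
    rw [← hmp.measure_preimage (hE.diff hZm).nullMeasurableSet]
    congr 1
    ext ⟨x, j⟩
    constructor
    · rintro ⟨⟨⟨hX, h0, -⟩, hT⟩, hp⟩
      have hT' : discT g δ (x, j) = (x, j + 1) := if_pos hp
      rw [mem_preimage, hT'] at hT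
      exact ⟨hT, by simp only [hZ, mem_ofPred_eq, Prod.map]; simp only at h0; omega⟩
    · rintro ⟨hT, hz⟩
      obtain ⟨hX, h0, hlt⟩ := hED hT
      have hp : (x, j) ∈ P := hlt
      have hT' : discT g δ (x, j) = (x, j + 1) := if_pos hp
      refine ⟨⟨⟨hX, ?_, ?_⟩, ?_⟩, hp⟩
      · simp only [hZ, mem_ofPred_eq, Prod.map] at hz h0 ⊢
        omega
      · simp only [Prod.map, id] at hlt ⊢
        push_cast at hlt
        linarith
      · rw [mem_preimage, hT']
        exact hT
  have hbase : M (E ∩ Z) = μ {x | (x, (0 : ℤ)) ∈ E} := by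
    have h : E ∩ Z = {x | (x, (0 : ℤ)) ∈ E} ×ˢ ({0} : Set ℤ) := by
      ext ⟨x, j⟩
      simp only [hZ, mem_inter_iff, mem_ofPred_eq, mem_prod, mem_singleton_iff]
      constructor <;> rintro ⟨h, rfl⟩ <;> exact ⟨h, rfl⟩
    rw [h, hM, Measure.prod_prod, Measure.count_singleton, mul_one]
  have htop : M ((D ∩ discT g δ ⁻¹' E) \ P) = μ {x | (x, (0 : ℤ)) ∈ E} := by
    rw [hM, Measure.prod_apply (hE'm.diff hPm), ← hinv _ hE0m,
      ← Measure.measure_inter_eq_of_ae (s := shiftMap a ⁻¹' {x | (x, (0 : ℤ)) ∈ E})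
        (t := SFT A) ((prob_compl_eq_zero_iff (measurableSet_SFT A)).2 hsupp),
      ← lintegral_indicator_one
        ((measurableSet_SFT A).inter (measurable_shiftMap a hE0m))]
    refine lintegral_congr fun x => ?_
    obtain ⟨N, hN⟩ := hgval x
    have hdiv : g x / δ = N := by rw [hN]; field_simp
    have hN1 : 1 ≤ N := by
      have h1 : (1 : ℝ) * δ ≤ N * δ := by simpa [hN] using hgδ x
      exact_mod_cast le_of_mul_le_mul_right h1 hδ
    have hmem : ∀ j : ℤ, (x, j) ∈ (D ∩ discT g δ ⁻¹' E) \ P ↔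
        j = N - 1 ∧ x ∈ SFT A ∩ shiftMap a ⁻¹' {x | (x, (0 : ℤ)) ∈ E} := by
      intro j
      have hPj : (x, j) ∈ P ↔ j + 1 < N := by
        simp only [hP, mem_ofPred_eq, hdiv, Int.cast_lt]
      have hDj : (x, j) ∈ D ↔ x ∈ SFT A ∧ 0 ≤ j ∧ j < N := by
        simp only [hD, discSusp, mem_ofPred_eq, hdiv, Int.cast_lt]
      have hTj : (x, j) ∉ P → discT g δ (x, j) = (shiftMap a x, 0) := fun h => if_neg h
      constructor
      · rintro ⟨⟨hd, hT⟩, hp⟩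
        rw [mem_preimage, hTj hp] at hT
        rw [hPj] at hp
        rw [hDj] at hd
        exact ⟨by omega, hd.1, hT⟩
      · rintro ⟨hj, hX, hT⟩
        have hp : (x, j) ∉ P := by rw [hPj]; omega
        refine ⟨⟨hDj.2 ⟨hX, by omega, by omega⟩, ?_⟩, hp⟩
        rw [mem_preimage, hTj hp]
        exact hT
    by_cases hx : x ∈ SFT A ∩ shiftMap a ⁻¹' {x | (x, (0 : ℤ)) ∈ E}
    · have hsec : Prod.mk x ⁻¹' ((D ∩ discT g δ ⁻¹' E) \ P) = {N - 1} := by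
        ext j
        rw [mem_preimage, hmem]
        simp only [hx, and_true, mem_singleton_iff]
      rw [hsec, indicator_of_mem hx, Measure.count_singleton, Pi.one_apply]
    · have hsec : Prod.mk x ⁻¹' ((D ∩ discT g δ ⁻¹' E) \ P) = ∅ := by
        ext j
        rw [mem_preimage, hmem]
        simp only [hx, and_false, mem_empty_iff_false]
      rw [hsec, indicator_of_notMem hx, measure_empty]
  rw [← measure_inter_add_sdiff (D ∩ discT g δ ⁻¹' E) hPm, hup, htop, ← hbase, add_comm,
    measure_inter_add_sdiff E hZm]

end Roof

/-- Thickening each fibre `{j}` to a set `J j` of constant measure scales the product measure. -/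
lemma prod_iUnion_sections {α β : Type*} [MeasurableSpace α] [MeasurableSpace β]
    (μ : Measure α) [SFinite μ] (ρ : Measure β) [SFinite ρ] {J : ℤ → Set β}
    (hJ : ∀ j, MeasurableSet (J j)) (hdisj : Pairwise (Function.onFun Disjoint J)) {c : ENNReal}
    (hc : ∀ j, ρ (J j) = c) {E : Set (α × ℤ)} (hE : MeasurableSet E) :
    (μ.prod ρ) (⋃ j, {x | (x, j) ∈ E} ×ˢ J j) = c * ∑' j, μ {x | (x, j) ∈ E} := by
  rw [measure_iUnion]
  · simp only [Measure.prod_prod, hc]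
    rw [ENNReal.tsum_mul_right, mul_comm]
  · intro i j hij
    exact Set.disjoint_prod.2 (Or.inr (hdisj hij))
  · exact fun j => (measurable_prodMk_right hE).prod (hJ j)

lemma prod_volume_thicken {α : Type*} [MeasurableSpace α] (μ : Measure α) [SFinite μ]
    {J : ℤ → Set ℝ} (hJ : ∀ j, MeasurableSet (J j))
    (hdisj : Pairwise (Function.onFun Disjoint J)) {c : ENNReal}
    (hc : ∀ j, volume (J j) = c) {E : Set (α × ℤ)} (hE : MeasurableSet E) :
    (μ.prod volume) (⋃ j, {x | (x, j) ∈ E} ×ˢ J j) = c * (μ.prod Measure.count) E := by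
  have hsplit : E = ⋃ j, {x | (x, j) ∈ E} ×ˢ ({j} : Set ℤ) := by
    ext ⟨x, j⟩
    simp
  have hcount := prod_iUnion_sections μ (Measure.count : Measure ℤ)
    (J := fun j => {j}) (fun j => measurableSet_singleton j)
    (fun i j hij => Set.disjoint_singleton.2 hij) (fun j => Measure.count_singleton j) hE
  rw [prod_iUnion_sections μ volume hJ hdisj hc hE]
  rw [← hsplit, one_mul] at hcount
  rw [hcount]

/-- For a roof function `g` constant on cylinders of length `m` with values
in `δℤ`, the continuous-time non-escape quantity at time `t > δ` is sandwiched between the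
discrete-time quantities at times `⌈t/δ⌉` and `⌊t/δ⌋`. -/
theorem discrete_continuous_K_sandwich
    (a : ℕ) (ha : 2 ≤ a) (A : Matrix (Fin a) (Fin a) ℕ)
    (hA01 : ∀ i j, A i j = 0 ∨ A i j = 1)
    (hAper : ∃ d : ℕ, 0 < d ∧ ∀ i j, 0 < (A ^ d) i j)
    (μ : Measure (ℕ → Fin a)) [IsProbabilityMeasure μ]
    (hsupp : μ (SFT A) = 1)
    (hinv : ∀ B : Set (ℕ → Fin a), MeasurableSet B → μ (shiftMap a ⁻¹' B) = μ B)
    (δ : ℝ) (hδ : 0 < δ) (m : ℕ)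
    (g : (ℕ → Fin a) → ℝ)
    (hgconst : ∀ x y : ℕ → Fin a, (∀ i < m, x i = y i) → g x = g y)
    (hgval : ∀ x : ℕ → Fin a, ∃ j : ℤ, g x = j * δ)
    (hgδ : ∀ x : ℕ → Fin a, δ ≤ g x)
    (I : Set (ℕ → Fin a)) (hI : MeasurableSet I) (hIX : I ⊆ SFT A)
    (hIcyl : ∀ x ∈ I, ∃ l : ℕ, m ≤ l ∧ SFT A ∩ cyl x l ⊆ I)
    (t : ℝ) (ht : δ < t) :
    KD (discMeasure μ (SFT A) g δ) ⌈t / δ⌉₊ (I ×ˢ ({0} : Set ℤ)) (SFT A) g δ ≤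
        Kc (suspMeasure μ (SFT A) g) t (I ×ˢ ({0} : Set ℝ)) (SFT A) g ∧
      Kc (suspMeasure μ (SFT A) g) t (I ×ˢ ({0} : Set ℝ)) (SFT A) g ≤
        KD (discMeasure μ (SFT A) g δ) ⌊t / δ⌋₊ (I ×ˢ ({0} : Set ℤ)) (SFT A) g δ := by
  have hgm : Measurable g := measurable_of_const_on_cylinders hgconst
  have hint : 0 < ∫ x, g x ∂μ := by
    have h := integral_mono (integrable_const δ) (integrable_of_const_on_cylinders μ hgconst) hgδ
    simp only [integral_const, probReal_univ, one_smul] at h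
    linarith
  set D := discSusp (SFT A) g δ with hD
  have hDm : MeasurableSet D := measurableSet_discSusp (measurableSet_SFT A) hgm
  set S : ℕ → Set ((ℕ → Fin a) × ℤ) :=
    fun K => {p | p ∈ D ∧ ∀ i < K, (discT g δ)^[i] p ∉ I ×ˢ ({0} : Set ℤ)} with hS
  have hSm : ∀ K, MeasurableSet (S K) := by
    intro K
    have h : S K = D ∩ ⋂ i, ⋂ (_ : i < K), (discT g δ)^[i] ⁻¹' (I ×ˢ ({0} : Set ℤ))ᶜ := by
      ext p
      simp [hS]
    rw [h]
    exact hDm.inter (MeasurableSet.iInter fun i => MeasurableSet.iInter fun _ =>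
      ((measurable_discT hgm).iterate i) (hI.prod (measurableSet_singleton 0)).compl)
  set S' : ℕ → Set ((ℕ → Fin a) × ℤ) := fun K => D ∩ discT g δ ⁻¹' S K with hS'
  have hS'm : ∀ K, MeasurableSet (S' K) := fun K => hDm.inter (measurable_discT hgm (hSm K))
  have hS'mem : ∀ K x j, (x, j) ∈ S' K ↔ (x ∈ SFT A ∧ 0 ≤ j ∧ j * δ < g x) ∧
      ∀ i < K, ∀ k, birkhoff g k x = (j + i + 1) * δ → (shiftMap a)^[k] x ∉ I := by
    intro K x j
    rw [← mem_discSusp_iff hδ]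
    refine and_congr_right fun hd => ?_
    obtain ⟨-, h0, hlt⟩ := (mem_discSusp_iff hδ).1 hd
    simp only [hS, mem_preimage, mem_ofPred_eq, ← Function.iterate_succ_apply]
    rw [and_iff_right (discT_mem_discSusp hδ hgδ hd)]
    refine forall₂_congr fun i _ => ?_
    rw [discT_iterate_mem_iff hδ hgδ hgval h0 hlt, not_exists]
    push_cast
    simp only [not_and, add_assoc]
  have hmeasure : ∀ (J : ℤ → Set ℝ), (∀ j, MeasurableSet (J j)) →
      (∀ j, J j ⊆ Ico (j * δ) ((j + 1) * δ)) → (∀ j, volume (J j) = ENNReal.ofReal δ) → ∀ K,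
      suspMeasure μ (SFT A) g (⋃ j, {x | (x, j) ∈ S' K} ×ˢ J j) =
        discMeasure μ (SFT A) g δ (S K) := by
    intro J hJ hsub hvol K
    have hdisj : Pairwise (Function.onFun Disjoint J) := by
      intro i j hij
      have h := pairwise_disjoint_Ico_zsmul δ hij
      simp only [Function.onFun, zsmul_eq_mul] at h
      push_cast at h
      exact h.mono (hsub i) (hsub j)
    have hUsub : (⋃ j, {x | (x, j) ∈ S' K} ×ˢ J j) ⊆ susp (SFT A) g := by
      rintro ⟨x, s⟩ h
      obtain ⟨j, hx, hs⟩ := mem_iUnion.1 h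
      obtain ⟨⟨hX, h0, hlt⟩, -⟩ := (hS'mem K x j).1 hx
      have h1 := add_one_mul_le_of_mul_lt hδ hgval hlt
      have h2 := hsub j hs
      have h3 : (0 : ℝ) ≤ j * δ := mul_nonneg (by exact_mod_cast h0) hδ.le
      exact ⟨hX, h3.trans h2.1, h2.2.trans_le h1⟩
    have hSD : S K ⊆ D := fun p hp => hp.1
    rw [suspMeasure, discMeasure, Measure.smul_apply, Measure.smul_apply,
      Measure.restrict_eq_self _ hUsub, Measure.restrict_eq_self _ hSD,
      prod_volume_thicken μ hJ hdisj hvol (hS'm K),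
      prod_count_preimage_discT hsupp hinv hδ hgm hgδ hgval (hSm K) hSD,
      ENNReal.ofReal_div_of_pos hint, smul_eq_mul, smul_eq_mul, ← mul_assoc, div_eq_mul_inv,
      mul_comm (ENNReal.ofReal _)⁻¹]
  constructor
  · refine ENNReal.log_monotone ?_
    have h := hmeasure (fun j => Ioo (j * δ) ((j + 1) * δ)) (fun _ => measurableSet_Ioo)
      (fun _ => Ioo_subset_Ico_self)
      (fun j => by rw [Real.volume_Ioo]; ring_nf) ⌈t / δ⌉₊
    refine h.symm.le.trans (measure_mono ?_)
    rintro ⟨x, s⟩ hxs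
    obtain ⟨j, hx, hs⟩ := mem_iUnion.1 hxs
    obtain ⟨⟨hX, h0, hlt⟩, hav⟩ := (hS'mem _ x j).1 hx
    have h1 := add_one_mul_le_of_mul_lt hδ hgval hlt
    have h3 : (0 : ℝ) ≤ j * δ := mul_nonneg (by exact_mod_cast h0) hδ.le
    obtain ⟨hs1, hs2⟩ : j * δ < s ∧ s < (j + 1) * δ := hs
    refine ⟨⟨hX, (h3.trans_lt hs1).le, hs2.trans_le h1⟩, ?_⟩
    rintro u ⟨hu0, hut⟩ hhit
    obtain ⟨k, hk, hkI⟩ := (susFlow_mem_iff hδ hgδ (by linarith)).1 hhit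
    obtain ⟨N, hN⟩ := exists_birkhoff_eq_int_mul hgval x k
    have hjN : j < N := by
      have h : (j : ℝ) * δ < N * δ := by linarith
      exact_mod_cast lt_of_mul_lt_mul_right h hδ.le
    have hNj : N < j + 1 + (⌈t / δ⌉₊ : ℤ) := by
      have hceil : t ≤ ⌈t / δ⌉₊ * δ := (div_le_iff₀ hδ).1 (Nat.le_ceil _)
      have h : (N : ℝ) * δ < (j + 1 + ⌈t / δ⌉₊) * δ := by linarith
      exact_mod_cast lt_of_mul_lt_mul_right h hδ.le
    obtain ⟨i, hi⟩ := Int.eq_ofNat_of_zero_le (show 0 ≤ N - j - 1 by omega)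
    refine hav i (by omega) k ?_ hkI
    have hNi : N = j + i + 1 := by omega
    rw [hN, hNi]
    push_cast
    ring
  · refine ENNReal.log_monotone ?_
    have h := hmeasure (fun j => Ico (j * δ) ((j + 1) * δ)) (fun _ => measurableSet_Ico)
      (fun _ => Subset.rfl)
      (fun j => by rw [Real.volume_Ico]; ring_nf) ⌊t / δ⌋₊
    refine le_trans (measure_mono ?_) h.le
    rintro ⟨x, s⟩ ⟨⟨hX, hs0, hsg⟩, hav⟩
    simp only at hX hs0 hsg
    have hs1 : ⌊s / δ⌋ * δ ≤ s := (le_div_iff₀ hδ).1 (Int.floor_le _)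
    have hs2 : s < (⌊s / δ⌋ + 1) * δ := (div_lt_iff₀ hδ).1 (Int.lt_floor_add_one _)
    refine mem_iUnion.2 ⟨⌊s / δ⌋, (hS'mem _ _ _).2 ⟨⟨hX, ?_, ?_⟩, ?_⟩, hs1, hs2⟩
    · exact Int.floor_nonneg.2 (div_nonneg hs0 hδ.le)
    · exact hs1.trans_lt hsg
    · intro i hi k hk hkI
      have hit : ((i : ℝ) + 1) * δ ≤ t := by
        rw [← le_div_iff₀ hδ]
        have h1 : ((i + 1 : ℕ) : ℝ) ≤ ⌊t / δ⌋₊ := by exact_mod_cast hi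
        push_cast at h1
        exact h1.trans (Nat.floor_le (div_nonneg (hδ.trans ht).le hδ.le))
      have hi0 : (0 : ℝ) ≤ i * δ := mul_nonneg (Nat.cast_nonneg i) hδ.le
      have hu0 : 0 ≤ birkhoff g k x - s := by rw [hk]; linarith
      refine hav (birkhoff g k x - s) ⟨hu0, by rw [hk]; linarith⟩ ?_
      exact (susFlow_mem_iff hδ hgδ (by linarith)).2 ⟨k, by ring, hkI⟩

end
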